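/- Let t ≥ 2 be an integer. If t is even, then limsup_{n→∞} (log₂ A(n,t))/n ≤ 1/2 + 1/(2t+2); if t is odd, then limsup_{n→∞} (log₂ A(n,t))/n ≤ 1/2 + 1/(2t). -/

import Mathlib

open Finset

/-- A binary code of length `n`: every coordinate of every codeword is 0 or 1. -/
def IsBinaryCode {n : ℕ} (C : Finset (Fin n → ℝ)) : Prop :=
  ∀ c ∈ C, ∀ i, c i = 0 ∨ c i = 1

/-- `C` is a `t`-signature code. -/
def IsSignatureCode {n : ℕ} (t : ℕ) (C : Finset (Fin n → ℝ)) : Prop :=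
  ∀ C₁ ⊆ C, ∀ C₂ ⊆ C, C₁ ≠ C₂ →
    1 ≤ C₁.card → C₁.card ≤ t → 1 ≤ C₂.card → C₂.card ≤ t →
    ∀ lam mu : (Fin n → ℝ) → ℝ,
      (∀ c ∈ C₁, 0 < lam c) → (∀ c ∈ C₂, 0 < mu c) →
      (∑ c ∈ C₁, lam c) = 1 → (∑ c ∈ C₂, mu c) = 1 →
      (∑ c ∈ C₁, lam c • c) ≠ (∑ c ∈ C₂, mu c • c)

/-- `A n t`: the maximum size of a `t`-signature code of length `n`. -/
noncomputable def Amax (n t : ℕ) : ℕ :=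
  sSup {M | ∃ C : Finset (Fin n → ℝ), IsBinaryCode C ∧ IsSignatureCode t C ∧ C.card = M}

/-- The unit flow along the pair `(u, w)`. -/
def unitFlow {V : Type*} [DecidableEq V] (u w a b : V) : ℤ :=
  (if a = u ∧ b = w then 1 else 0) - (if a = w ∧ b = u then 1 else 0)

lemma sum_unitFlow {V : Type*} [Fintype V] [DecidableEq V] (u w a : V) :
    ∑ b, unitFlow u w a b = (if a = u then 1 else 0) - (if a = w then 1 else 0) := by
  simp [unitFlow, Finset.sum_sub_distrib, ite_and]

lemma sum_abs_unitFlow_le {V : Type*} [Fintype V] [DecidableEq V] (u w : V) :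
    ∑ a, ∑ b, |unitFlow u w a b| ≤ 2 := by
  calc ∑ a, ∑ b, |unitFlow u w a b|
      ≤ ∑ a, ∑ b, ((if a = u ∧ b = w then 1 else 0) + (if a = w ∧ b = u then 1 else 0) : ℤ) := by
        refine sum_le_sum fun a _ => sum_le_sum fun b _ => ?_
        unfold unitFlow
        split_ifs <;> simp
    _ = 2 := by simp [Finset.sum_add_distrib, ite_and]

/-- A graph has no nonzero integral circulation using at most `2 * r` edges. -/
def NoShortCirculation {V : Type*} [Fintype V] (G : SimpleGraph V) (r : ℕ) : Prop :=
  ∀ f : V → V → ℤ, (∀ u v, f u v = -f v u) → (∀ u v, ¬ G.Adj u v → f u v = 0) →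
    (∀ u, ∑ v, f u v = 0) → ∑ u, ∑ v, |f u v| ≤ 4 * r → ∀ u v, f u v = 0

namespace SimpleGraph

variable {V : Type*} [DecidableEq V] {G : SimpleGraph V}

/-- The antisymmetric flow of one unit along a walk. -/
def Walk.flow {x u : V} : G.Walk x u → V → V → ℤ
  | .nil, _, _ => 0
  | .cons (u := y) (v := w) _ p, a, b => unitFlow y w a b + p.flow a b

lemma Walk.flow_antisymm {x u : V} (p : G.Walk x u) (a b : V) : p.flow a b = -p.flow b a := by
  induction p with
  | nil => simp [flow]
  | cons h p ih =>
    simp only [flow, ih, unitFlow, and_comm]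
    ring

lemma Walk.flow_eq_zero_of_not_adj {x u : V} (p : G.Walk x u) {a b : V} (hab : ¬ G.Adj a b) :
    p.flow a b = 0 := by
  induction p with
  | nil => simp [flow]
  | cons h p ih =>
    rw [flow, ih, unitFlow, if_neg, if_neg]
    · simp
    · rintro ⟨rfl, rfl⟩; exact hab h.symm
    · rintro ⟨rfl, rfl⟩; exact hab h

lemma Walk.flow_eq_zero_of_notMem {x u : V} (p : G.Walk x u) {a : V} (b : V)
    (ha : a ∉ p.support) : p.flow a b = 0 := by
  induction p with
  | nil => simp [flow]
  | cons h p ih =>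
    simp only [Walk.support_cons, List.mem_cons, not_or] at ha
    rw [flow, ih ha.2, unitFlow, if_neg, if_neg]
    · simp
    · rintro ⟨rfl, rfl⟩; exact ha.2 p.start_mem_support
    · rintro ⟨rfl, rfl⟩; exact ha.1 rfl

lemma Walk.sum_flow [Fintype V] {x u : V} (p : G.Walk x u) (a : V) :
    ∑ b, p.flow a b = (if a = x then 1 else 0) - (if a = u then 1 else 0) := by
  induction p with
  | nil => simp [flow]
  | cons h p ih =>
    simp only [flow]
    rw [Finset.sum_add_distrib, sum_unitFlow, ih]
    ring

lemma Walk.sum_abs_flow_le [Fintype V] {x u : V} (p : G.Walk x u) :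
    ∑ a, ∑ b, |p.flow a b| ≤ 2 * p.length := by
  induction p with
  | nil => simp [flow]
  | @cons x w u h p ih =>
    calc ∑ a, ∑ b, |unitFlow x w a b + p.flow a b|
        ≤ ∑ a, ∑ b, (|unitFlow x w a b| + |p.flow a b|) :=
          sum_le_sum fun a _ => sum_le_sum fun b _ => abs_add_le _ _
      _ ≤ 2 + 2 * p.length := by
          simp only [Finset.sum_add_distrib]
          exact add_le_add (sum_abs_unitFlow_le x w) ih
      _ = _ := by simp; ring

lemma Walk.flow_cons_start {x w v : V} (h : G.Adj v w) (p : G.Walk w x) (hv : v ∉ p.support)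
    (b : V) : (Walk.cons h p).flow v b = if b = w then 1 else 0 := by
  simp [flow, p.flow_eq_zero_of_notMem b hv, unitFlow, h.ne]

variable [Fintype V] {r : ℕ}

lemma _root_.NoShortCirculation.eq_of_adj (hG : NoShortCirculation G r) {x v w₁ w₂ : V}
    (p₁ : G.Walk x w₁) (p₂ : G.Walk x w₂)
    (hv₁ : v ∉ p₁.support) (hv₂ : v ∉ p₂.support) (h₁ : G.Adj v w₁) (h₂ : G.Adj v w₂)
    (hlen : p₁.length + p₂.length + 2 ≤ 2 * r) : w₁ = w₂ := by
  set q₁ := Walk.cons h₁ p₁.reverse with hq₁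
  set q₂ := Walk.cons h₂ p₂.reverse with hq₂
  have key := hG (fun a b => q₁.flow a b - q₂.flow a b) ?_ ?_ ?_ ?_ v w₁
  · simp only [hq₁, hq₂] at key
    rw [Walk.flow_cons_start _ _ (by simpa using hv₁),
      Walk.flow_cons_start _ _ (by simpa using hv₂)] at key
    by_contra hne
    simp [hne] at key
  · intro a b
    simp only [q₁.flow_antisymm a b, q₂.flow_antisymm a b]
    ring
  · intro a b hab
    simp [Walk.flow_eq_zero_of_not_adj _ hab]
  · intro a
    simp [Finset.sum_sub_distrib, Walk.sum_flow]
  · calc ∑ a, ∑ b, |q₁.flow a b - q₂.flow a b|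
        ≤ ∑ a, ∑ b, (|q₁.flow a b| + |q₂.flow a b|) :=
          sum_le_sum fun a _ => sum_le_sum fun b _ => abs_sub _ _
      _ ≤ 2 * q₁.length + 2 * q₂.length := by
          simp only [Finset.sum_add_distrib]
          exact add_le_add q₁.sum_abs_flow_le q₂.sum_abs_flow_le
      _ ≤ 4 * r := by
          simp [hq₁, hq₂]
          omega

omit [Fintype V] in
lemma Reachable.exists_walk_notMem_support {x v w : V} (hw : G.Reachable x w) (hvw : v ≠ w)
    (hd : G.dist x w ≤ G.dist x v) :
    ∃ p : G.Walk x w, p.length = G.dist x w ∧ v ∉ p.support := by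
  obtain ⟨p, hp⟩ := hw.exists_walk_length_eq_dist
  refine ⟨p, hp, fun hv => ?_⟩
  have h1 := p.length_takeUntil_lt_length hv hvw
  have h2 := dist_le (p.takeUntil v hv)
  omega

open Classical in
/-- The vertices at distance exactly `i` from `x`. -/
noncomputable def layer (G : SimpleGraph V) (x : V) (i : ℕ) : Finset V :=
  {v | G.Reachable x v ∧ G.dist x v = i}

open Classical in
lemma _root_.NoShortCirculation.card_layer_mul_le (hG : NoShortCirculation G r) {x : V} {i d : ℕ}
    (hi : i < r) (hd : ∀ v ∈ G.layer x i, d + 1 ≤ #{w | G.Adj v w}) :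
    #(G.layer x i) * d ≤ #(G.layer x (i + 1)) := by
  rw [← mul_one #(G.layer x (i + 1))]
  refine card_mul_le_card_mul G.Adj (fun v hv => ?_) (fun v hv => ?_)
  · have hdeg := hd v hv
    simp only [layer, mem_filter, mem_univ, true_and] at hv
    obtain ⟨hrv, hdv⟩ := hv
    have hsub : ({w | G.Adj v w} : Finset V) ⊆
        (G.layer x (i + 1)).bipartiteAbove G.Adj v ∪
          ({w | G.Adj v w ∧ G.dist x w ≤ i} : Finset V) := by
      intro w hw
      simp only [mem_filter, mem_univ, true_and] at hw
      have hrw : G.Reachable x w := hrv.trans hw.reachable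
      have hle : G.dist x w ≤ i + 1 := by
        obtain ⟨p, hp⟩ := hrv.exists_walk_length_eq_dist
        have := dist_le (p.concat hw)
        simp only [Walk.length_concat] at this
        omega
      simp only [mem_union, mem_bipartiteAbove, layer, mem_filter, mem_univ, true_and, and_true,
        hw, hrw]
      omega
    have hone : #({w | G.Adj v w ∧ G.dist x w ≤ i} : Finset V) ≤ 1 := by
      rw [card_le_one]
      intro w₁ hw₁ w₂ hw₂
      simp only [mem_filter, mem_univ, true_and] at hw₁ hw₂
      obtain ⟨p₁, hp₁, hv₁⟩ := (hrv.trans hw₁.1.reachable).exists_walk_notMem_support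
        hw₁.1.ne (by omega)
      obtain ⟨p₂, hp₂, hv₂⟩ := (hrv.trans hw₂.1.reachable).exists_walk_notMem_support
        hw₂.1.ne (by omega)
      exact hG.eq_of_adj p₁ p₂ hv₁ hv₂ hw₁.1 hw₂.1 (by omega)
    have := (card_le_card hsub).trans (card_union_le _ _)
    omega
  · simp only [layer, mem_filter, mem_univ, true_and] at hv
    rw [card_le_one]
    intro w₁ hw₁ w₂ hw₂
    simp only [mem_bipartiteBelow, layer, mem_filter, mem_univ, true_and] at hw₁ hw₂
    obtain ⟨p₁, hp₁, hv₁⟩ := hw₁.1.1.exists_walk_notMem_support hw₁.2.symm.ne (by omega)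
    obtain ⟨p₂, hp₂, hv₂⟩ := hw₂.1.1.exists_walk_notMem_support hw₂.2.symm.ne (by omega)
    exact hG.eq_of_adj p₁ p₂ hv₁ hv₂ hw₁.2.symm hw₂.2.symm (by omega)

end SimpleGraph

section Bipartite

variable {A B : Type*} [Fintype A] [Fintype B] [DecidableEq A] [DecidableEq B]

/-- No nonzero integral combination of at most `2 * t` edges in `E` has all its vertex sums zero. -/
def NoShortDependency (E : Finset (A × B)) (t : ℕ) : Prop :=
  ∀ g : A × B → ℤ, (∀ p ∉ E, g p = 0) → (∀ a, ∑ b, g (a, b) = 0) → (∀ b, ∑ a, g (a, b) = 0) →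
    ∑ p, |g p| ≤ 2 * t → ∀ p, g p = 0

/-- The bipartite graph with edge set `E`. -/
def bipartiteGraph (E : Finset (A × B)) : SimpleGraph (A ⊕ B) where
  Adj
    | .inl a, .inr b => (a, b) ∈ E
    | .inr b, .inl a => (a, b) ∈ E
    | _, _ => False
  symm := ⟨by rintro (a | b) (a' | b') h <;> exact h⟩
  loopless := ⟨by rintro (a | b) h <;> exact h⟩

omit [Fintype A] [Fintype B] [DecidableEq A] [DecidableEq B] in
@[simp] lemma bipartiteGraph_adj_inl_inr {E : Finset (A × B)} {a : A} {b : B} :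
    (bipartiteGraph E).Adj (.inl a) (.inr b) ↔ (a, b) ∈ E := Iff.rfl

omit [Fintype A] [Fintype B] [DecidableEq A] [DecidableEq B] in
@[simp] lemma bipartiteGraph_adj_inr_inl {E : Finset (A × B)} {a : A} {b : B} :
    (bipartiteGraph E).Adj (.inr b) (.inl a) ↔ (a, b) ∈ E := Iff.rfl

omit [Fintype A] [Fintype B] [DecidableEq A] [DecidableEq B] in
@[simp] lemma not_bipartiteGraph_adj_inl_inl {E : Finset (A × B)} {a a' : A} :
    ¬ (bipartiteGraph E).Adj (.inl a) (.inl a') := fun h => h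

omit [Fintype A] [Fintype B] [DecidableEq A] [DecidableEq B] in
@[simp] lemma not_bipartiteGraph_adj_inr_inr {E : Finset (A × B)} {b b' : B} :
    ¬ (bipartiteGraph E).Adj (.inr b) (.inr b') := fun h => h

omit [DecidableEq A] [DecidableEq B] in
lemma NoShortDependency.noShortCirculation {E : Finset (A × B)} {t : ℕ}
    (hE : NoShortDependency E t) : NoShortCirculation (bipartiteGraph E) t := by
  intro f hanti hadj hsum habs
  have hll : ∀ a a', f (.inl a) (.inl a') = 0 := fun a a' => hadj _ _ (by simp)
  have hrr : ∀ b b', f (.inr b) (.inr b') = 0 := fun a a' => hadj _ _ (by simp)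
  have hlr : ∀ p : A × B, f (.inl p.1) (.inr p.2) = 0 := by
    refine hE (fun p => f (.inl p.1) (.inr p.2)) (fun p hp => hadj _ _ (by simpa using hp)) ?_ ?_ ?_
    · intro a
      simpa [hll] using hsum (.inl a)
    · intro b
      have := hsum (.inr b)
      simp only [Fintype.sum_sum_type, hrr, sum_const_zero, add_zero] at this
      simp only [hanti (.inl _) (.inr _), sum_neg_distrib, this, neg_zero]
    · have h1 : ∑ b, ∑ a, |f (.inr b) (.inl a)| = ∑ a, ∑ b, |f (.inl a) (.inr b)| := by
        rw [sum_comm]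
        simp only [hanti (.inr _) (.inl _), abs_neg]
      simp only [Fintype.sum_sum_type, hrr, hll, abs_zero, sum_const_zero, add_zero, zero_add,
        h1] at habs
      rw [Fintype.sum_prod_type]
      dsimp only
      linarith
  rintro (a | b) (a' | b')
  · exact hll a a'
  · exact hlr (a, b')
  · rw [hanti, hlr (a', b), neg_zero]
  · exact hrr b b'

/-- The colouring of the bipartite graph by its two sides. -/
def bipartiteGraphColoring (E : Finset (A × B)) : (bipartiteGraph E).Coloring Bool :=
  .mk Sum.isLeft (by rintro (a | b) (a' | b') h <;> simp_all)

lemma isLeft_iff_even_of_mem_layer {E : Finset (A × B)} {a : A} {v : A ⊕ B} {i : ℕ}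
    (hv : v ∈ (bipartiteGraph E).layer (.inl a) i) : v.isLeft ↔ Even i := by
  simp only [SimpleGraph.layer, mem_filter, mem_univ, true_and] at hv
  obtain ⟨p, hp⟩ := hv.1.exists_walk_length_eq_dist
  have := (bipartiteGraphColoring E).even_length_iff_congr p
  rw [hp, hv.2] at this
  rw [this]
  change _ ↔ (Sum.isLeft (Sum.inl a : A ⊕ B) = true ↔ v.isLeft = true)
  simp

lemma exists_adj_of_mem_layer {V : Type*} [Fintype V] [DecidableEq V] {G : SimpleGraph V} {x y v : V}
    {i : ℕ} (hxy : G.Adj x y) (hv : v ∈ G.layer x i) : ∃ w, G.Adj v w := by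
  simp only [SimpleGraph.layer, mem_filter, mem_univ, true_and] at hv
  obtain ⟨p⟩ := hv.1.symm
  cases p with
  | nil => exact ⟨y, hxy⟩
  | cons h _ => exact ⟨_, h⟩

lemma NoShortDependency.pow_le_card {E : Finset (A × B)} {s d : ℕ}
    (hE : NoShortDependency E (2 * s)) (hne : E.Nonempty)
    (hA : ∀ a b, (a, b) ∈ E → d + 1 ≤ #{b' | (a, b') ∈ E})
    (hB : ∀ a b, (a, b) ∈ E → 2 ≤ #{a' | (a', b) ∈ E}) : d ^ s ≤ Fintype.card A := by
  classical
  obtain ⟨⟨a₀, b₀⟩, h₀⟩ := hne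
  have hG := hE.noShortCirculation
  set G := bipartiteGraph E with hGdef
  have hadj : G.Adj (.inl a₀) (.inr b₀) := h₀
  have hleft : ∀ i, Even i → i < 2 * s →
      #(G.layer (.inl a₀) i) * d ≤ #(G.layer (.inl a₀) (i + 1)) := by
    refine fun i hi his => hG.card_layer_mul_le his fun v hv => ?_
    obtain ⟨w, hw⟩ := exists_adj_of_mem_layer hadj hv
    have hl := (isLeft_iff_even_of_mem_layer hv).2 hi
    obtain ⟨a, rfl⟩ := Sum.isLeft_iff.1 hl
    rcases w with a' | b
    · exact absurd hw (by simp [hGdef])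
    · refine (hA a b hw).trans (card_le_card_of_injOn Sum.inr ?_ Sum.inr_injective.injOn)
      intro b' hb'
      simpa [hGdef] using hb'
  have hright : ∀ i, ¬ Even i → i < 2 * s →
      #(G.layer (.inl a₀) i) * 1 ≤ #(G.layer (.inl a₀) (i + 1)) := by
    refine fun i hi his => hG.card_layer_mul_le his fun v hv => ?_
    obtain ⟨w, hw⟩ := exists_adj_of_mem_layer hadj hv
    have hl := (isLeft_iff_even_of_mem_layer hv).not.2 hi
    rcases v with a | b
    · simp at hl
    rcases w with a | b'
    · refine (hB a b hw).trans (card_le_card_of_injOn Sum.inl ?_ Sum.inl_injective.injOn)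
      intro a' ha'
      simpa [hGdef] using ha'
    · exact absurd hw (by simp [hGdef])
  have hpow : ∀ k ≤ s, d ^ k ≤ #(G.layer (.inl a₀) (2 * k)) := by
    intro k
    induction k with
    | zero =>
      intro _
      rw [pow_zero, Nat.one_le_iff_ne_zero, card_ne_zero]
      exact ⟨.inl a₀, by simp [SimpleGraph.layer]⟩
    | succ k ih =>
      intro hk
      have h1 := hleft (2 * k) (by simp) (by omega)
      have h2 := hright (2 * k + 1) (by simp) (by omega)
      rw [mul_one] at h2
      calc d ^ (k + 1) = d ^ k * d := pow_succ _ _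
        _ ≤ _ := Nat.mul_le_mul_right d (ih (by omega))
        _ ≤ _ := h1.trans h2
  refine (hpow s le_rfl).trans ?_
  rw [← card_univ, ← card_map (s := univ) (Function.Embedding.inl (β := B))]
  refine card_le_card fun v hv => ?_
  obtain ⟨a, rfl⟩ := Sum.isLeft_iff.1 ((isLeft_iff_even_of_mem_layer hv).2 (by simp))
  simp

omit [Fintype A] [Fintype B] in
lemma exists_subset_minDegree (E : Finset (A × B)) (d e : ℕ)
    (hE : d * #(E.image Prod.fst) + e * #(E.image Prod.snd) < #E) :
    ∃ F ⊆ E, F.Nonempty ∧ (∀ a b, (a, b) ∈ F → d + 1 ≤ #{p ∈ F | p.1 = a}) ∧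
      (∀ a b, (a, b) ∈ F → e + 1 ≤ #{p ∈ F | p.2 = b}) := by
  induction E using Finset.strongInduction with
  | H E ih =>
    by_cases hdA : ∃ a b, (a, b) ∈ E ∧ #{p ∈ E | p.1 = a} ≤ d
    · obtain ⟨a, b, hab, hd⟩ := hdA
      have hss : {p ∈ E | ¬ p.1 = a} ⊂ E := filter_ssubset.2 ⟨(a, b), hab, by simp⟩
      have h1 := card_filter_add_card_filter_not (s := E) (fun p => p.1 = a)
      have h2 : #(image Prod.fst {p ∈ E | ¬ p.1 = a}) + 1 ≤ #(image Prod.fst E) := by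
        refine card_lt_card (ssubset_iff_of_subset (image_subset_image hss.subset) |>.2
          ⟨a, mem_image_of_mem Prod.fst hab, by simp⟩)
      have h3 := card_le_card (image_subset_image (f := Prod.snd) hss.subset)
      obtain ⟨F, hF, h⟩ := ih _ hss (by nlinarith)
      exact ⟨F, hF.trans hss.subset, h⟩
    by_cases hdB : ∃ a b, (a, b) ∈ E ∧ #{p ∈ E | p.2 = b} ≤ e
    · obtain ⟨a, b, hab, hd⟩ := hdB
      have hss : {p ∈ E | ¬ p.2 = b} ⊂ E := filter_ssubset.2 ⟨(a, b), hab, by simp⟩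
      have h1 := card_filter_add_card_filter_not (s := E) (fun p => p.2 = b)
      have h2 : #(image Prod.snd {p ∈ E | ¬ p.2 = b}) + 1 ≤ #(image Prod.snd E) := by
        refine card_lt_card (ssubset_iff_of_subset (image_subset_image hss.subset) |>.2
          ⟨b, mem_image_of_mem Prod.snd hab, by simp⟩)
      have h3 := card_le_card (image_subset_image (f := Prod.fst) hss.subset)
      obtain ⟨F, hF, h⟩ := ih _ hss (by nlinarith)
      exact ⟨F, hF.trans hss.subset, h⟩
    push Not at hdA hdB
    exact ⟨E, Subset.rfl, card_pos.1 (by omega), hdA, hdB⟩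

lemma NoShortDependency.card_le {E : Finset (A × B)} {s d : ℕ}
    (hE : NoShortDependency E (2 * s)) (hd : Fintype.card A < d ^ s) :
    #E ≤ d * Fintype.card A + Fintype.card B := by
  by_contra! hlt
  obtain ⟨F, hFE, hne, hA, hB⟩ := exists_subset_minDegree E d 1 <| by
    have h1 := card_le_univ (E.image Prod.fst)
    have h2 := card_le_univ (E.image Prod.snd)
    nlinarith
  have hF : NoShortDependency F (2 * s) := fun g hg => hE g fun p hp => hg p fun h => hp (hFE h)
  refine hd.not_ge (hF.pow_le_card hne (fun a b hab => (hA a b hab).trans ?_)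
    (fun a b hab => (hB a b hab).trans ?_))
  · refine card_le_card_of_injOn Prod.snd ?_ ?_
    · rintro ⟨a', b'⟩ h
      simp only [coe_filter, Set.mem_ofPred_eq] at h
      obtain ⟨h, rfl⟩ := h
      simpa using h
    · rintro ⟨a₁, b₁⟩ h₁ ⟨a₂, b₂⟩ h₂ h
      simp only [coe_filter, Set.mem_ofPred_eq] at h₁ h₂ h
      rw [h₁.2, h₂.2, h]
  · refine card_le_card_of_injOn Prod.fst ?_ ?_
    · rintro ⟨a', b'⟩ h
      simp only [coe_filter, Set.mem_ofPred_eq] at h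
      obtain ⟨h, rfl⟩ := h
      simpa using h
    · rintro ⟨a₁, b₁⟩ h₁ ⟨a₂, b₂⟩ h₂ h
      simp only [coe_filter, Set.mem_ofPred_eq] at h₁ h₂ h
      rw [h₁.2, h₂.2, h]

end Bipartite

section Codes

lemma IsSignatureCode.eq_zero_of_dependency {n t : ℕ} {C : Finset (Fin n → ℝ)}
    (hC : IsSignatureCode t C) (h : (Fin n → ℝ) → ℤ) (hsum : ∑ c ∈ C, h c = 0)
    (hvec : ∑ c ∈ C, (h c : ℝ) • c = 0) (habs : ∑ c ∈ C, |h c| ≤ 2 * t) : ∀ c ∈ C, h c = 0 := by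
  classical
  by_contra! hne
  obtain ⟨c₀, hc₀, hne⟩ := hne
  set P := C.filter fun c => 0 < h c with hP
  set N := C.filter fun c => h c < 0 with hN
  have hPN : ∀ {M : Type} [AddCommGroup M] (F : (Fin n → ℝ) → M), (∀ c, h c = 0 → F c = 0) →
      ∑ c ∈ C, F c = ∑ c ∈ P, F c + ∑ c ∈ N, F c := by
    intro M _ F hF
    rw [hP, hN, sum_filter, sum_filter, ← sum_add_distrib]
    refine sum_congr rfl fun c _ => ?_
    rcases lt_trichotomy (h c) 0 with hc | hc | hc
    · simp [hc, hc.le]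
    · simp [hF c hc]
    · simp [hc, hc.le]
  have hposP : ∀ c ∈ P, 0 < h c := fun c hc => (mem_filter.1 hc).2
  have hnegN : ∀ c ∈ N, h c < 0 := fun c hc => (mem_filter.1 hc).2
  set K := ∑ c ∈ P, h c with hK
  have hNK : ∑ c ∈ N, h c = -K := by
    have := hPN h (fun _ => id)
    omega
  have hKt : 2 * K ≤ 2 * t := by
    have h1 := hPN (fun c => |h c|) (fun c hc => by simp [hc])
    have h2 : ∑ c ∈ P, |h c| = K := sum_congr rfl fun c hc => abs_of_pos (hposP c hc)
    have h3 : ∑ c ∈ N, |h c| = K := by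
      rw [sum_congr rfl fun c hc => abs_of_neg (hnegN c hc), sum_neg_distrib, hNK, neg_neg]
    omega
  have hPcard : (#P : ℤ) ≤ K := by
    simpa using card_nsmul_le_sum P h 1 fun c hc => hposP c hc
  have hNcard : (#N : ℤ) ≤ K := by
    have := card_nsmul_le_sum N (fun c => -h c) 1 fun c hc => by have := hnegN c hc; omega
    simpa [hNK] using this
  have hKpos : 0 < K := by
    rcases lt_or_gt_of_ne hne with hc | hc
    · have : 0 < #N := card_pos.2 ⟨c₀, mem_filter.2 ⟨hc₀, hc⟩⟩
      omega
    · have : 0 < #P := card_pos.2 ⟨c₀, mem_filter.2 ⟨hc₀, hc⟩⟩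
      omega
  have hKR : (0 : ℝ) < K := by exact_mod_cast hKpos
  have hP1 : 1 ≤ #P := by
    by_contra! h0
    rw [Nat.lt_one_iff, card_eq_zero] at h0
    rw [hK, h0, sum_empty] at hKpos
    exact lt_irrefl _ hKpos
  have hN1 : 1 ≤ #N := by
    by_contra! h0
    rw [Nat.lt_one_iff, card_eq_zero] at h0
    rw [h0, sum_empty] at hNK
    omega
  refine hC P (filter_subset _ _) N (filter_subset _ _) ?_ hP1 (by omega) hN1 (by omega)
    (fun c => h c / K) (fun c => -h c / K) ?_ ?_ ?_ ?_ ?_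
  · intro hPN'
    obtain ⟨c, hc⟩ := card_pos.1 hP1
    have := hposP c hc
    have := hnegN c (hPN' ▸ hc)
    omega
  · exact fun c hc => div_pos (by exact_mod_cast hposP c hc) hKR
  · exact fun c hc => div_pos (by have := hnegN c hc; rw [neg_pos]; exact_mod_cast this) hKR
  · rw [← sum_div, div_eq_one_iff_eq hKR.ne']
    exact_mod_cast hK.symm
  · rw [← sum_div, div_eq_one_iff_eq hKR.ne', sum_neg_distrib, neg_eq_iff_eq_neg]
    exact_mod_cast hNK
  · have h1 := hPN (fun c => (h c : ℝ) • c) (fun c hc => by simp [hc])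
    rw [hvec] at h1
    have h2 : ∀ S : Finset (Fin n → ℝ), ∑ c ∈ S, ((h c : ℝ) / K) • c =
        (K : ℝ)⁻¹ • ∑ c ∈ S, (h c : ℝ) • c := by
      intro S
      rw [smul_sum]
      exact sum_congr rfl fun c _ => by rw [smul_smul, div_eq_inv_mul]
    simp only [neg_div, neg_smul, sum_neg_distrib, h2]
    rw [← smul_neg, eq_neg_of_add_eq_zero_left h1.symm]

/-- The binary word whose coordinates below `k` are `p.1` and whose other coordinates are `p.2`. -/
def mergeWord {n k : ℕ}
    (p : ({i : Fin n // (i : ℕ) < k} → Bool) × ({i : Fin n // ¬ (i : ℕ) < k} → Bool)) :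
    Fin n → ℝ := fun i =>
  if h : (i : ℕ) < k then (if p.1 ⟨i, h⟩ then 1 else 0) else (if p.2 ⟨i, h⟩ then 1 else 0)

open Classical in
/-- The parts of a word below `k` and from `k` on. -/
noncomputable def splitWord {n : ℕ} (k : ℕ) (c : Fin n → ℝ) :
    ({i : Fin n // (i : ℕ) < k} → Bool) × ({i : Fin n // ¬ (i : ℕ) < k} → Bool) :=
  (fun i => decide (c i = 1), fun i => decide (c i = 1))

lemma splitWord_mergeWord {n k : ℕ}
    (p : ({i : Fin n // (i : ℕ) < k} → Bool) × ({i : Fin n // ¬ (i : ℕ) < k} → Bool)) :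
    splitWord k (mergeWord p) = p := by
  refine Prod.ext (funext fun i => ?_) (funext fun i => ?_) <;> simp [splitWord, mergeWord, i.2]

lemma mergeWord_splitWord {n : ℕ} (k : ℕ) {c : Fin n → ℝ} (hc : ∀ i, c i = 0 ∨ c i = 1) :
    mergeWord (splitWord k c) = c := by
  funext i
  rcases hc i with h | h <;> simp [splitWord, mergeWord, h]

open Classical in
/-- A code regarded as the edge set of a bipartite graph. -/
noncomputable def codeEdges {n : ℕ} (k : ℕ) (C : Finset (Fin n → ℝ)) :
    Finset (({i : Fin n // (i : ℕ) < k} → Bool) × ({i : Fin n // ¬ (i : ℕ) < k} → Bool)) :=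
  {p | mergeWord p ∈ C}

lemma sum_codeEdges {n : ℕ} (k : ℕ) {C : Finset (Fin n → ℝ)} (hC : IsBinaryCode C)
    {M : Type*} [AddCommMonoid M] (F : (Fin n → ℝ) → M) :
    ∑ p ∈ codeEdges k C, F (mergeWord p) = ∑ c ∈ C, F c := by
  refine sum_nbij' mergeWord (splitWord k) ?_ ?_ ?_ ?_ ?_
  · intro p hp; simpa [codeEdges] using hp
  · intro c hc; simpa [codeEdges, mergeWord_splitWord k (hC c hc)] using hc
  · intro p _; exact splitWord_mergeWord p
  · intro c hc; exact mergeWord_splitWord k (hC c hc)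
  · intro p _; rfl

lemma card_codeEdges {n : ℕ} (k : ℕ) {C : Finset (Fin n → ℝ)} (hC : IsBinaryCode C) :
    #(codeEdges k C) = #C := by
  simpa only [card_eq_sum_ones] using sum_codeEdges k hC (fun _ => 1)

lemma IsSignatureCode.noShortDependency {n t : ℕ} (k : ℕ) {C : Finset (Fin n → ℝ)}
    (hb : IsBinaryCode C) (hC : IsSignatureCode t C) : NoShortDependency (codeEdges k C) t := by
  intro g hg hA hB habs
  have htr : ∀ {M : Type} [AddCommMonoid M] (F : ℤ → (Fin n → ℝ) → M), (∀ c, F 0 c = 0) →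
      ∑ c ∈ C, F (g (splitWord k c)) c = ∑ p, F (g p) (mergeWord p) := by
    intro M _ F hF
    rw [← sum_codeEdges k hb]
    simp only [splitWord_mergeWord]
    exact sum_subset (subset_univ _) fun p _ hp => by rw [hg p hp, hF]
  have h0 := hC.eq_zero_of_dependency (fun c => g (splitWord k c)) ?_ ?_ ?_
  · intro p
    by_cases hp : p ∈ codeEdges k C
    · simpa [splitWord_mergeWord] using h0 (mergeWord p) (by simpa [codeEdges] using hp)
    · exact hg p hp
  · rw [htr (fun z _ => z) (by simp), Fintype.sum_prod_type]
    simp [hA]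
  · rw [htr (fun z c => (z : ℝ) • c) (by simp)]
    funext i
    rw [Finset.sum_apply]
    by_cases hi : (i : ℕ) < k
    · rw [Fintype.sum_prod_type]
      refine sum_eq_zero fun a _ => ?_
      simp only [Pi.smul_apply, mergeWord, hi, dite_true, smul_eq_mul]
      change ∑ b, (g (a, b) : ℝ) * (if a ⟨i, hi⟩ then 1 else 0) = 0
      rw [← sum_mul, ← Int.cast_sum, hA, Int.cast_zero, zero_mul]
    · rw [Fintype.sum_prod_type_right]
      refine sum_eq_zero fun b _ => ?_
      simp only [Pi.smul_apply, mergeWord, hi, dite_false, smul_eq_mul]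
      change ∑ a, (g (a, b) : ℝ) * (if b ⟨i, hi⟩ then 1 else 0) = 0
      rw [← sum_mul, ← Int.cast_sum, hB, Int.cast_zero, zero_mul]
  · rw [htr (fun z _ => |z|) (by simp)]
    exact habs

lemma IsSignatureCode.card_le_pow {n s m : ℕ} (hs : 1 ≤ s) (hn : n ≤ (2 * s + 1) * m)
    {C : Finset (Fin n → ℝ)} (hb : IsBinaryCode C) (hC : IsSignatureCode (2 * s) C) :
    #C ≤ 2 ^ ((s + 1) * m + 2) := by
  have hcA : Fintype.card ({i : Fin n // (i : ℕ) < s * m} → Bool) ≤ 2 ^ (s * m) := by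
    rw [Fintype.card_fun, Fintype.card_bool]
    refine Nat.pow_le_pow_right two_pos ?_
    refine le_of_le_of_eq ?_ (Fintype.card_fin (s * m))
    refine Fintype.card_le_of_injective (fun i => (⟨i.1, i.2⟩ : Fin (s * m))) fun i j hij => ?_
    simpa [Subtype.ext_iff, Fin.ext_iff] using hij
  have hcB : Fintype.card ({i : Fin n // ¬ (i : ℕ) < s * m} → Bool) ≤ 2 ^ ((s + 1) * m) := by
    rw [Fintype.card_fun, Fintype.card_bool]
    refine Nat.pow_le_pow_right two_pos ?_
    refine le_of_le_of_eq ?_ (Fintype.card_fin ((s + 1) * m))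
    refine Fintype.card_le_of_injective
      (fun i => (⟨i.1 - s * m, ?_⟩ : Fin ((s + 1) * m))) fun i j hij => ?_
    · have := i.1.2
      have := i.2
      nlinarith [Nat.sub_add_cancel (not_lt.1 i.2)]
    · have h1 := i.2
      have h2 := j.2
      rw [Fin.mk.injEq] at hij
      rw [Subtype.ext_iff, Fin.ext_iff]
      omega
  have hlt : 2 ^ (s * m) < (2 ^ (m + 1)) ^ s := by
    rw [← pow_mul]
    refine Nat.pow_lt_pow_right one_lt_two ?_
    nlinarith
  have hmain := (hC.noShortDependency (s * m) hb).card_le (hcA.trans_lt hlt)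
  rw [card_codeEdges _ hb] at hmain
  calc #C ≤ 2 ^ (m + 1) * 2 ^ (s * m) + 2 ^ ((s + 1) * m) :=
        hmain.trans (add_le_add (Nat.mul_le_mul_left _ hcA) hcB)
    _ = 3 * 2 ^ ((s + 1) * m) := by ring
    _ ≤ 2 ^ ((s + 1) * m + 2) := by rw [pow_add]; omega

lemma IsSignatureCode.mono {n t t' : ℕ} (htt : t ≤ t') {C : Finset (Fin n → ℝ)}
    (hC : IsSignatureCode t' C) : IsSignatureCode t C :=
  fun C₁ h₁ C₂ h₂ hne a₁ b₁ a₂ b₂ =>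
    hC C₁ h₁ C₂ h₂ hne a₁ (b₁.trans htt) a₂ (b₂.trans htt)

lemma Amax_le_pow {n s t : ℕ} (hs : 1 ≤ s) (hst : 2 * s ≤ t) :
    Amax n t ≤ 2 ^ ((s + 1) * (n / (2 * s + 1) + 1) + 2) := by
  refine csSup_le ⟨0, ∅, by simp [IsBinaryCode], ?_, rfl⟩ ?_
  · intro C₁ h₁ C₂ h₂ hne
    exact absurd ((subset_empty.1 h₁).trans (subset_empty.1 h₂).symm) hne
  · rintro _ ⟨C, hb, hC, rfl⟩
    refine (hC.mono hst).card_le_pow hs ?_ hb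
    exact (Nat.lt_mul_div_succ n (by omega)).le

lemma limsup_logb_Amax_le {s t : ℕ} (hs : 1 ≤ s) (hst : 2 * s ≤ t) :
    Filter.atTop.limsup (fun n : ℕ => Real.logb 2 (Amax n t) / n) ≤
      ((s : ℝ) + 1) / (2 * s + 1) := by
  have hnonneg : ∀ n, 0 ≤ Real.logb 2 (Amax n t) := fun n => by
    rcases Nat.eq_zero_or_pos (Amax n t) with h | h
    · simp [h]
    · exact Real.logb_nonneg one_lt_two (by exact_mod_cast h)
  have hlog : ∀ n : ℕ, Real.logb 2 (Amax n t) ≤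
      ((s : ℝ) + 1) / (2 * s + 1) * n + ((s : ℝ) + 3) := by
    intro n
    have hle : Real.logb 2 (Amax n t) ≤ ((s + 1) * (n / (2 * s + 1) + 1) + 2 : ℕ) := by
      rcases Nat.eq_zero_or_pos (Amax n t) with h | h
      · rw [h, Nat.cast_zero, Real.logb_zero]
        positivity
      · rw [Real.logb_le_iff_le_rpow one_lt_two (by exact_mod_cast h), Real.rpow_natCast]
        exact_mod_cast Amax_le_pow hs hst
    refine hle.trans ?_
    have hdiv : ((n / (2 * s + 1) : ℕ) : ℝ) ≤ n / (2 * s + 1) := by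
      simpa using Nat.cast_div_le (α := ℝ) (m := n) (n := 2 * s + 1)
    push_cast at hdiv ⊢
    calc ((s : ℝ) + 1) * (((n / (2 * s + 1) : ℕ) : ℝ) + 1) + 2
        ≤ (s + 1) * ((n : ℝ) / (2 * s + 1) + 1) + 2 := by gcongr
      _ = _ := by ring
  have htend : Filter.Tendsto (fun n : ℕ => ((s : ℝ) + 1) / (2 * s + 1) + ((s : ℝ) + 3) / n)
      Filter.atTop (nhds (((s : ℝ) + 1) / (2 * s + 1))) := by
    simpa using tendsto_const_nhds.add (tendsto_const_div_atTop_nhds_zero_nat ((s : ℝ) + 3))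
  rw [← htend.limsup_eq]
  refine Filter.limsup_le_limsup ?_ ?_ htend.isBoundedUnder_le
  · filter_upwards [Filter.eventually_gt_atTop 0] with n hn
    have hn' : (0 : ℝ) < n := by exact_mod_cast hn
    rw [div_le_iff₀ hn', add_mul, div_mul_cancel₀ _ hn'.ne']
    exact hlog n
  · exact Filter.isCoboundedUnder_le_of_le Filter.atTop (x := 0)
      fun n => div_nonneg (hnonneg n) n.cast_nonneg

end Codes

theorem stmt_7 (t : ℕ) (ht : 2 ≤ t) :
    (Even t →
      Filter.atTop.limsup (fun n : ℕ => Real.logb 2 (Amax n t) / n) ≤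
        1 / 2 + 1 / (2 * (t : ℝ) + 2)) ∧
    (Odd t →
      Filter.atTop.limsup (fun n : ℕ => Real.logb 2 (Amax n t) / n) ≤
        1 / 2 + 1 / (2 * (t : ℝ))) := by
  constructor
  · rintro ⟨s, rfl⟩
    refine (limsup_logb_Amax_le (s := s) (by omega) (by omega)).trans_eq ?_
    push_cast
    field_simp
    ring
  · rintro ⟨s, rfl⟩
    refine (limsup_logb_Amax_le (s := s) (by omega) (by omega)).trans_eq ?_
    push_cast
    field_simp
    ring
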